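/- The matrices satisfy NQ = P², where P = ∫₀^∞ e^{−As} B C e^{−As} ds. -/

import Mathlib

open Matrix MeasureTheory Filter

noncomputable def mexp {p : ℕ} (M : Matrix (Fin p) (Fin p) ℝ) : Matrix (Fin p) (Fin p) ℝ :=
  ∑' k : ℕ, (k.factorial : ℝ)⁻¹ • M ^ k

def EigPos {p : ℕ} (A : Matrix (Fin p) (Fin p) ℝ) : Prop :=
  ∀ μ ∈ spectrum ℂ (A.map Complex.ofReal), 0 < μ.re

def Observable {p : ℕ} (A : Matrix (Fin p) (Fin p) ℝ) (C : Matrix (Fin 1) (Fin p) ℝ) : Prop :=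
  ∀ v : Fin p → ℝ, (∀ r : ℕ, (C * A ^ r) *ᵥ v = 0) → v = 0

def Controllable {p : ℕ} (A : Matrix (Fin p) (Fin p) ℝ) (B : Matrix (Fin p) (Fin 1) ℝ) : Prop :=
  ∀ v : Fin p → ℝ, (∀ r : ℕ, (Bᵀ * Aᵀ ^ r) *ᵥ v = 0) → v = 0

noncomputable def Qmat {p : ℕ} (A : Matrix (Fin p) (Fin p) ℝ) (C : Matrix (Fin 1) (Fin p) ℝ) :
    Matrix (Fin p) (Fin p) ℝ :=
  Matrix.of fun i j =>
    ∫ s in Set.Ioi (0 : ℝ), (mexp (-(s • Aᵀ)) * (Cᵀ * C) * mexp (-(s • A))) i j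

noncomputable def Nmat {p : ℕ} (A : Matrix (Fin p) (Fin p) ℝ) (B : Matrix (Fin p) (Fin 1) ℝ) :
    Matrix (Fin p) (Fin p) ℝ :=
  Matrix.of fun i j =>
    ∫ s in Set.Ioi (0 : ℝ), (mexp (-(s • A)) * (B * Bᵀ) * mexp (-(s • Aᵀ))) i j

noncomputable def Pmat {p : ℕ} (A : Matrix (Fin p) (Fin p) ℝ) (B : Matrix (Fin p) (Fin 1) ℝ)
    (C : Matrix (Fin 1) (Fin p) ℝ) : Matrix (Fin p) (Fin p) ℝ :=
  Matrix.of fun i j =>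
    ∫ s in Set.Ioi (0 : ℝ), (mexp (-(s • A)) * (B * C) * mexp (-(s • A))) i j

noncomputable def Fmat {p : ℕ} (A : Matrix (Fin p) (Fin p) ℝ) (B : Matrix (Fin p) (Fin 1) ℝ)
    (C : Matrix (Fin 1) (Fin p) ℝ) (x t : ℝ) : Matrix (Fin p) (Fin p) ℝ :=
  mexp ((2 * x) • Aᵀ - (8 * t) • Aᵀ ^ 3) +
    Qmat A C * mexp (-((2 * x) • A) + (8 * t) • A ^ 3) * Nmat A B

noncomputable def Emat {p : ℕ} (A : Matrix (Fin p) (Fin p) ℝ) (B : Matrix (Fin p) (Fin 1) ℝ)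
    (C : Matrix (Fin 1) (Fin p) ℝ) (x t : ℝ) : Matrix (Fin p) (Fin p) ℝ :=
  mexp ((2 * x) • A - (8 * t) • A ^ 3) +
    Pmat A B C * mexp (-((2 * x) • A) + (8 * t) • A ^ 3) * Pmat A B C

noncomputable def uFun {p : ℕ} (A : Matrix (Fin p) (Fin p) ℝ) (B : Matrix (Fin p) (Fin 1) ℝ)
    (C : Matrix (Fin 1) (Fin p) ℝ) (x t : ℝ) : ℝ :=
  -2 * ((Bᵀ * (Fmat A B C x t)⁻¹ * Cᵀ : Matrix (Fin 1) (Fin 1) ℝ) 0 0)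

noncomputable def vFun {p : ℕ} (A : Matrix (Fin p) (Fin p) ℝ) (B : Matrix (Fin p) (Fin 1) ℝ)
    (C : Matrix (Fin 1) (Fin p) ℝ) (x t : ℝ) : ℝ :=
  -2 * ((C * (Emat A B C x t)⁻¹ * B : Matrix (Fin 1) (Fin 1) ℝ) 0 0)

noncomputable def calQ {p : ℕ} (A : Matrix (Fin p) (Fin p) ℝ) (C : Matrix (Fin 1) (Fin p) ℝ)
    (x t : ℝ) : Matrix (Fin p) (Fin p) ℝ :=
  mexp (-(x • Aᵀ)) * mexp ((8 * t) • Aᵀ ^ 3) * Qmat A C * mexp (-(x • A)) * mexp ((8 * t) • A ^ 3)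

noncomputable def calN {p : ℕ} (A : Matrix (Fin p) (Fin p) ℝ) (B : Matrix (Fin p) (Fin 1) ℝ)
    (x : ℝ) : Matrix (Fin p) (Fin p) ℝ :=
  mexp (-(x • A)) * Nmat A B * mexp (-(x • Aᵀ))

noncomputable def Gam {p : ℕ} (A : Matrix (Fin p) (Fin p) ℝ) (B : Matrix (Fin p) (Fin 1) ℝ)
    (C : Matrix (Fin 1) (Fin p) ℝ) (x t : ℝ) : Matrix (Fin p) (Fin p) ℝ :=
  1 + calQ A C x t * calN A B x

noncomputable def Om {p : ℕ} (A : Matrix (Fin p) (Fin p) ℝ) (B : Matrix (Fin p) (Fin 1) ℝ)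
    (C : Matrix (Fin 1) (Fin p) ℝ) (w t : ℝ) : ℝ :=
  ((C * mexp (-(w • A)) * mexp ((8 * t) • A ^ 3) * B : Matrix (Fin 1) (Fin 1) ℝ) 0 0)

noncomputable def Kker {p : ℕ} (A : Matrix (Fin p) (Fin p) ℝ) (B : Matrix (Fin p) (Fin 1) ℝ)
    (C : Matrix (Fin 1) (Fin p) ℝ) (x y t : ℝ) : ℝ :=
  ((Bᵀ * (Fmat A B C x t)⁻¹ * mexp (-((y - x) • Aᵀ)) * Cᵀ : Matrix (Fin 1) (Fin 1) ℝ) 0 0)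


section helpers
attribute [local instance] Matrix.linftyOpNormedRing Matrix.linftyOpNormedAlgebra

theorem hx_mexp_eq {p : ℕ} (M : Matrix (Fin p) (Fin p) ℝ) : mexp M = NormedSpace.exp M := by
  rw [NormedSpace.exp_eq_tsum ℝ]; rfl

theorem hx_hasSum {p : ℕ} (M : Matrix (Fin p) (Fin p) ℂ) :
    HasSum (fun n : ℕ => ((n.factorial : ℂ)⁻¹) • M ^ n) (NormedSpace.exp M) :=
  NormedSpace.exp_series_hasSum_exp' (𝕂 := ℂ) M

theorem hx_cont {p : ℕ} (M : Matrix (Fin p) (Fin p) ℝ) :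
    Continuous (fun s : ℝ => NormedSpace.exp (-(s • M))) := by
  have h : Continuous (NormedSpace.exp : Matrix (Fin p) (Fin p) ℝ → _) :=
    NormedSpace.exp_continuous
  exact h.comp (by fun_prop)

end helpers

theorem hx_map {p : ℕ} (M : Matrix (Fin p) (Fin p) ℝ) :
    (NormedSpace.exp M).map Complex.ofReal = NormedSpace.exp (M.map Complex.ofReal) := by
  have h := (hx_hasSum (M.map Complex.ofReal))
  have h2 : (fun n : ℕ => ((n.factorial : ℂ)⁻¹) • (M.map Complex.ofReal) ^ n)
     = fun n : ℕ => (((n.factorial : ℝ)⁻¹) • M ^ n).map Complex.ofReal := by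
    funext n
    have : (M.map Complex.ofReal) ^ n = (M ^ n).map Complex.ofReal :=
      (map_pow (Complex.ofRealHom.mapMatrix) M n).symm
    rw [this]
    ext i j
    simp
  rw [h2] at h
  have h3 : HasSum (fun n : ℕ => ((n.factorial : ℝ)⁻¹) • M ^ n) (NormedSpace.exp M) := by
    let _ := Matrix.linftyOpNormedRing (n := Fin p) (α := ℝ)
    let _ := Matrix.linftyOpNormedAlgebra (n := Fin p) (α := ℝ) (R := ℝ)
    exact NormedSpace.exp_series_hasSum_exp' (𝕂 := ℝ) M
  have h4 := h3.map (Complex.ofRealHom.mapMatrix (m := Fin p)).toAddMonoidHom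
    (show Continuous (fun X : Matrix (Fin p) (Fin p) ℝ => X.map Complex.ofReal) from
      Continuous.matrix_map continuous_id Complex.continuous_ofReal)
  exact h4.unique h

theorem hx_exp_gen {p : ℕ} (M : Matrix (Fin p) (Fin p) ℂ) (l : ℂ) (v : Fin p → ℂ) (k : ℕ)
    (hk : ((M - l • 1) ^ k) *ᵥ v = 0) (s : ℝ) :
    NormedSpace.exp (-((s : ℂ) • M)) *ᵥ v =
      ∑ n ∈ Finset.range k, (Complex.exp (-(s * l)) * ((n.factorial : ℂ)⁻¹ * (-(s : ℂ)) ^ n)) •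
        (((M - l • 1) ^ n) *ᵥ v) := by
  have e1 : -((s : ℂ) • M) = (-(s * l)) • (1 : Matrix (Fin p) (Fin p) ℂ)
      + (-(s : ℂ)) • (M - l • 1) := by
    ext i j; simp; ring
  have e2 : NormedSpace.exp ((-(s * l)) • (1 : Matrix (Fin p) (Fin p) ℂ))
      = Complex.exp (-(s * l)) • (1 : Matrix (Fin p) (Fin p) ℂ) := by
    rw [Matrix.smul_one_eq_diagonal, Matrix.exp_diagonal, Matrix.smul_one_eq_diagonal]
    congr 1
    funext i
    rw [Complex.exp_eq_exp_ℂ, Pi.coe_exp]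
  rw [e1, Matrix.exp_add_of_commute _ _ ((Commute.one_left _).smul_left _), e2]
  have h := hx_hasSum ((-(s : ℂ)) • (M - l • 1))
  have h4 := h.map (⟨⟨fun X : Matrix (Fin p) (Fin p) ℂ => X *ᵥ v, by simp⟩,
      fun X Y => Matrix.add_mulVec X Y v⟩ : Matrix (Fin p) (Fin p) ℂ →+ (Fin p → ℂ))
    (show Continuous (fun X : Matrix (Fin p) (Fin p) ℂ => X *ᵥ v) from
      Continuous.matrix_mulVec continuous_id continuous_const)
  have h5 := hasSum_sum_of_ne_finset_zero (f := fun n : ℕ =>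
      ((n.factorial : ℂ)⁻¹ • ((-(s : ℂ)) • (M - l • 1)) ^ n) *ᵥ v) (s := Finset.range k)
      (L := SummationFilter.unconditional ℕ) (by
    intro n hn
    have : k ≤ n := by simpa using hn
    obtain ⟨d, rfl⟩ := Nat.exists_eq_add_of_le' this
    simp only [smul_pow]
    rw [Matrix.smul_mulVec, Matrix.smul_mulVec, pow_add (M - l • 1) d k, ← Matrix.mulVec_mulVec, hk]
    simp)
  have h6 := h4.unique h5
  change NormedSpace.exp ((-(s : ℂ)) • (M - l • 1)) *ᵥ v = _ at h6
  rw [← Matrix.mulVec_mulVec, h6, Matrix.smul_mulVec, Matrix.one_mulVec, Finset.smul_sum]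
  refine Finset.sum_congr rfl fun n _ => ?_
  rw [smul_pow, Matrix.smul_mulVec, Matrix.smul_mulVec, smul_smul, smul_smul, mul_assoc]

def HxDecay {E : Type*} [Norm E] (f : ℝ → E) : Prop :=
  ∃ b : ℝ, 0 < b ∧ f =O[atTop] (fun s : ℝ => Real.exp (-b * s))

theorem hx_exp_mono {b c : ℝ} (h : b ≤ c) :
    (fun s : ℝ => Real.exp (-c * s)) =O[atTop] (fun s : ℝ => Real.exp (-b * s)) := by
  refine Asymptotics.IsBigO.of_bound 1 ?_
  filter_upwards [eventually_ge_atTop 0] with s hs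
  simp only [Real.norm_eq_abs, Real.abs_exp, one_mul, Real.exp_le_exp]
  nlinarith

theorem HxDecay.add {E : Type*} [NormedAddCommGroup E] {f g : ℝ → E} (hf : HxDecay f)
    (hg : HxDecay g) : HxDecay (fun s => f s + g s) := by
  obtain ⟨b, hb, h1⟩ := hf
  obtain ⟨c, hc, h2⟩ := hg
  exact ⟨min b c, lt_min hb hc, (h1.trans (hx_exp_mono (min_le_left _ _))).add
    (h2.trans (hx_exp_mono (min_le_right _ _)))⟩

theorem HxDecay.zero {E : Type*} [NormedAddCommGroup E] : HxDecay (fun _ : ℝ => (0 : E)) :=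
  ⟨1, one_pos, Asymptotics.isBigO_zero _ _⟩

theorem HxDecay.sum {E ι : Type*} [NormedAddCommGroup E] (t : Finset ι) {f : ι → ℝ → E}
    (hf : ∀ i ∈ t, HxDecay (f i)) : HxDecay (fun s => ∑ i ∈ t, f i s) := by
  classical
  induction t using Finset.induction_on with
  | empty => simpa using HxDecay.zero
  | insert a t ha ih =>
    simp only [Finset.sum_insert ha]
    exact (hf a (by simp)).add (ih fun i hi => hf i (by simp [hi]))

theorem HxDecay.mul {f g : ℝ → ℝ} (hf : HxDecay f)
    (hg : HxDecay g) : HxDecay (fun s => f s * g s) := by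
  obtain ⟨b, hb, h1⟩ := hf
  obtain ⟨c, hc, h2⟩ := hg
  refine ⟨b + c, add_pos hb hc, ?_⟩
  refine (h1.mul h2).congr_right fun s => ?_
  rw [← Real.exp_add]; congr 1; ring

theorem HxDecay.mul_const {f : ℝ → ℝ} (hf : HxDecay f) (c : ℝ) : HxDecay (fun s => f s * c) := by
  obtain ⟨b, hb, h1⟩ := hf
  refine ⟨b, hb, ?_⟩
  simpa [mul_comm] using h1.const_mul_left c

theorem hx_scalar (l : ℂ) (hl : 0 < l.re) (c : ℂ) (n : ℕ) :
    HxDecay (fun s : ℝ => Complex.exp (-(s * l)) * (c * (-(s : ℂ)) ^ n)) := by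
  refine ⟨l.re / 2, by linarith, ?_⟩
  have h := (isLittleO_pow_exp_pos_mul_atTop n (b := l.re / 2) (by linarith)).isBigO
  have h1 : (fun s : ℝ => Real.exp (-(l.re) * s) * s ^ n) =O[atTop]
      fun s : ℝ => Real.exp (-(l.re / 2) * s) := by
    refine ((Asymptotics.isBigO_refl (fun s : ℝ => Real.exp (-(l.re) * s)) atTop).mul h).congr_right
      fun s => ?_
    rw [← Real.exp_add]; congr 1; ring
  refine Asymptotics.IsBigO.trans ?_ h1
  refine Asymptotics.IsBigO.of_bound ‖c‖ (Eventually.of_forall fun s => ?_)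
  simp only [norm_mul, norm_pow, norm_neg, Complex.norm_exp, Complex.norm_real, Real.norm_eq_abs,
    Real.abs_exp]
  have : (-((s : ℂ) * l)).re = - l.re * s := by simp; ring
  rw [this]
  apply le_of_eq; ring

theorem hx_decay_vec {p : ℕ} (M : Matrix (Fin p) (Fin p) ℂ)
    (hM : ∀ μ ∈ spectrum ℂ M, 0 < μ.re) (v : Fin p → ℂ) :
    HxDecay (fun s : ℝ => NormedSpace.exp (-((s : ℂ) • M)) *ᵥ v) := by
  have hv : v ∈ ⨆ μ : ℂ, Module.End.maxGenEigenspace (Matrix.toLin' M) μ := by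
    rw [Module.End.iSup_maxGenEigenspace_eq_top]; trivial
  induction hv using Submodule.iSup_induction' with
  | zero => simpa using HxDecay.zero
  | add x y _ _ hx hy => simpa only [Matrix.mulVec_add] using hx.add hy
  | mem l x hx =>
    by_cases hx0 : x = 0
    · subst hx0; simpa using HxDecay.zero
    have hl : 0 < l.re := by
      apply hM
      rw [← Matrix.spectrum_toLin']
      apply Module.End.HasEigenvalue.mem_spectrum
      have : Module.End.HasUnifEigenvalue (Matrix.toLin' M) l ⊤ := by
        intro h
        apply hx0
        have : x ∈ (⊥ : Submodule ℂ (Fin p → ℂ)) := by rw [← h]; exact hx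
        simpa using this
      exact this.lt (by simp)
    obtain ⟨k, hk⟩ := (Module.End.mem_maxGenEigenspace _ _ _).1 hx
    have hk' : ((M - l • 1) ^ k) *ᵥ x = 0 := by
      rw [← hk, ← Matrix.toLin'_apply, Matrix.toLin'_pow, map_sub, map_smul, Matrix.toLin'_one]
      rfl
    simp_rw [hx_exp_gen M l x k hk']
    refine HxDecay.sum _ fun n _ => ?_
    obtain ⟨b, hb, h⟩ := hx_scalar l hl ((n.factorial : ℂ)⁻¹) n
    refine ⟨b, hb, ?_⟩
    refine Asymptotics.IsBigO.trans ?_ h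
    refine Asymptotics.IsBigO.of_bound ‖((M - l • 1) ^ n) *ᵥ x‖ (Eventually.of_forall fun s => ?_)
    rw [norm_smul, mul_comm]

theorem hx_decay {p : ℕ} (A : Matrix (Fin p) (Fin p) ℝ) (hA : EigPos A) (i j : Fin p) :
    HxDecay (fun s : ℝ => mexp (-(s • A)) i j) := by
  obtain ⟨b, hb, h⟩ := hx_decay_vec (A.map Complex.ofReal) hA (Pi.single j 1)
  refine ⟨b, hb, Asymptotics.IsBigO.trans ?_ h⟩
  refine Asymptotics.IsBigO.of_bound 1 (Eventually.of_forall fun s => ?_)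
  have e : -((s : ℂ) • A.map Complex.ofReal) = (-(s • A)).map Complex.ofReal := by
    ext i j; simp
  rw [e, ← hx_map, one_mul]
  refine le_trans (le_of_eq ?_) (norm_le_pi_norm _ i)
  rw [hx_mexp_eq]
  simp

theorem hx_integrable {f : ℝ → ℝ} (hc : Continuous f) (hf : HxDecay f) :
    Integrable f (volume.restrict (Set.Ioi 0)) := by
  obtain ⟨b, hb, h⟩ := hf
  exact integrable_of_isBigO_exp_neg hb hc.continuousOn h

theorem hx_prod {p : ℕ} (F G : ℝ → Matrix (Fin p) (Fin p) ℝ)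
    (hF : ∀ i j, Integrable (fun s => F s i j) (volume.restrict (Set.Ioi 0)))
    (hG : ∀ i j, Integrable (fun s => G s i j) (volume.restrict (Set.Ioi 0))) (i j : Fin p) :
    ((Matrix.of fun i j => ∫ s in Set.Ioi (0 : ℝ), F s i j) *
      (Matrix.of fun i j => ∫ s in Set.Ioi (0 : ℝ), G s i j) : Matrix (Fin p) (Fin p) ℝ) i j =
    ∫ z, (F z.1 * G z.2) i j
      ∂((volume.restrict (Set.Ioi (0 : ℝ))).prod (volume.restrict (Set.Ioi (0 : ℝ)))) := by
  simp only [Matrix.mul_apply, Matrix.of_apply]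
  rw [integral_finsetSum]
  · exact Finset.sum_congr rfl fun k _ => (integral_prod_mul _ _).symm
  · exact fun k _ => (hF i k).mul_prod (hG k j)

theorem hx_int {p : ℕ} (E G : ℝ → Matrix (Fin p) (Fin p) ℝ) (M : Matrix (Fin p) (Fin p) ℝ)
    (hE : ∀ i j, HxDecay (fun s => E s i j)) (hG : ∀ i j, HxDecay (fun s => G s i j))
    (cE : Continuous E) (cG : Continuous G) (i j : Fin p) :
    Integrable (fun s => (E s * M * G s) i j) (volume.restrict (Set.Ioi 0)) := by
  apply hx_integrable
  · exact ((cE.mul continuous_const).mul cG).matrix_elem i j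
  · simp only [Matrix.mul_apply]
    exact HxDecay.sum _ fun k _ => (HxDecay.sum _ fun l _ => (hE _ _).mul_const _).mul (hG _ _)

theorem statement8 {p : ℕ} (hp : 0 < p) (A : Matrix (Fin p) (Fin p) ℝ)
    (B : Matrix (Fin p) (Fin 1) ℝ) (C : Matrix (Fin 1) (Fin p) ℝ)
    (hA : EigPos A) (hobs : Observable A C) (hctrl : Controllable A B) :
    Nmat A B * Qmat A C = Pmat A B C ^ 2 := by
  have hT : ∀ s : ℝ, mexp (-(s • Aᵀ)) = (mexp (-(s • A)))ᵀ := by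
    intro s
    rw [hx_mexp_eq, hx_mexp_eq, ← Matrix.exp_transpose]
    simp
  have hcm : ∀ s t : ℝ, mexp (-(s • A)) * mexp (-(t • A)) = mexp (-(t • A)) * mexp (-(s • A)) := by
    intro s t
    have h : Commute (-(s • A)) (-(t • A)) :=
      (((Commute.refl A).smul_left s).smul_right t).neg_left.neg_right
    simp only [hx_mexp_eq]
    rw [← Matrix.exp_add_of_commute _ _ h, ← Matrix.exp_add_of_commute _ _ h.symm, add_comm]
  have hc : Continuous (fun s : ℝ => mexp (-(s • A))) := by
    simp only [hx_mexp_eq]; exact hx_cont A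
  have hd := hx_decay A hA
  have hcT : Continuous (fun s : ℝ => mexp (-(s • Aᵀ))) := by
    simp only [hT]; exact hc.matrix_transpose
  have hdT : ∀ i j, HxDecay (fun s : ℝ => mexp (-(s • Aᵀ)) i j) := by
    intro i j; simp only [hT]; exact hd j i
  rw [pow_two]
  ext i j
  unfold Nmat Qmat Pmat
  rw [hx_prod _ _ (hx_int _ _ _ hd hdT hc hcT) (hx_int _ _ _ hdT hd hcT hc),
    hx_prod _ _ (hx_int _ _ _ hd hd hc hc) (hx_int _ _ _ hd hd hc hc)]
  congr 1
  funext z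
  obtain ⟨s, t⟩ := z
  simp only [hT]
  have key : Bᵀ * (mexp (-(s • A)))ᵀ * ((mexp (-(t • A)))ᵀ * Cᵀ)
      = C * mexp (-(s • A)) * (mexp (-(t • A)) * B) := by
    have h1 : ∀ X : Matrix (Fin 1) (Fin 1) ℝ, Xᵀ = X := by
      intro X; ext a b; fin_cases a; fin_cases b; rfl
    rw [← h1 (C * mexp (-(s • A)) * (mexp (-(t • A)) * B))]
    rw [Matrix.mul_assoc C, ← Matrix.mul_assoc (mexp (-(s • A))), hcm]
    simp only [Matrix.transpose_mul, Matrix.mul_assoc]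
  have main : mexp (-(s • A)) * (B * Bᵀ) * (mexp (-(s • A)))ᵀ *
      ((mexp (-(t • A)))ᵀ * (Cᵀ * C) * mexp (-(t • A))) =
      mexp (-(s • A)) * (B * C) * mexp (-(s • A)) *
        (mexp (-(t • A)) * (B * C) * mexp (-(t • A))) := by
    calc _ = mexp (-(s • A)) * B * (Bᵀ * (mexp (-(s • A)))ᵀ * ((mexp (-(t • A)))ᵀ * Cᵀ)) *
          (C * mexp (-(t • A))) := by simp only [Matrix.mul_assoc]
      _ = _ := by rw [key]; simp only [Matrix.mul_assoc]
  rw [main]
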